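/- Let r be a positive integer and let G be a connected non-bipartite simple graph with m edges, where m ≥ (240r)², such that G is B_{r+1}-free (every two adjacent vertices have at most r common neighbors). Let ρ = ρ(G) be its spectral radius. Then ρ² < m − 1 + 2/(ρ − 1), unless G is isomorphic to S⁺_{m,s} for some s ∈ {1, 2, …, r} with s dividing m − 1. -/

import Mathlib

open Classical in
/-- The (classical) real adjacency matrix of a simple graph. -/
noncomputable def adjMat {V : Type*} (G : SimpleGraph V) : Matrix V V ℝ :=
  Matrix.of fun i j => if G.Adj i j then (1 : ℝ) else 0

theorem adjMat_isHermitian {V : Type*} (G : SimpleGraph V) :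
    (adjMat G).IsHermitian := by
  classical
  unfold Matrix.IsHermitian
  ext i j
  simp only [Matrix.conjTranspose_apply, adjMat, Matrix.of_apply, star_trivial]
  by_cases h : G.Adj i j
  · simp [h, h.symm]
  · have h' : ¬ G.Adj j i := fun hh => h hh.symm
    simp [h, h']

/-- The spectral radius of a finite simple graph: the largest eigenvalue of its
adjacency matrix. -/
noncomputable def specRad {V : Type*} [Fintype V] [DecidableEq V] (G : SimpleGraph V) : ℝ :=
  ⨆ i, (adjMat_isHermitian G).eigenvalues i


/-- `SPlus s t` is the graph obtained from the complete bipartite graph `K_{s,t}`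
(on parts `Fin s` and `Fin t`) by adding one edge inside the part of size `t`
(joining the vertices with values `0` and `1`).  For `s ∣ m - 1` and
`t = (m-1)/s ≥ 2` this is the graph `S⁺_{m,s}`, with exactly `m` edges. -/
def SPlus (s t : ℕ) : SimpleGraph (Fin s ⊕ Fin t) :=
  SimpleGraph.fromRel (fun a b =>
    (a.isLeft ∧ b.isRight) ∨
      (∃ i j : Fin t, a = Sum.inr i ∧ b = Sum.inr j ∧ (i : ℕ) = 0 ∧ (j : ℕ) = 1))

open Finset

theorem adjMat_apply {V : Type*} (G : SimpleGraph V) [DecidableRel G.Adj] (v w : V) :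
    adjMat G v w = if G.Adj v w then 1 else 0 := by
  simp [adjMat]

theorem adjMat_symm {V : Type*} (G : SimpleGraph V) (v w : V) : adjMat G v w = adjMat G w v := by
  classical
  simp [adjMat_apply, G.adj_comm]

theorem adjMat_nonneg {V : Type*} (G : SimpleGraph V) (v w : V) : 0 ≤ adjMat G v w := by
  classical
  rw [adjMat_apply]; split_ifs <;> norm_num

theorem adjMat_le_one {V : Type*} (G : SimpleGraph V) (v w : V) : adjMat G v w ≤ 1 := by
  classical
  rw [adjMat_apply]; split_ifs <;> norm_num

section Spectral

variable {V : Type*} [Fintype V] [DecidableEq V]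

theorem posSemidef_specRad_sub (G : SimpleGraph V) :
    (specRad G • (1 : Matrix V V ℝ) - adjMat G).PosSemidef := by
  have hA := adjMat_isHermitian G
  have h1 : specRad G • (1 : Matrix V V ℝ) - adjMat G =
      (hA.eigenvectorUnitary : Matrix V V ℝ) *
        Matrix.diagonal (fun i => specRad G - hA.eigenvalues i) *
        (hA.eigenvectorUnitary : Matrix V V ℝ).conjTranspose := by
    have h2 := hA.spectral_theorem
    have h3 : (hA.eigenvectorUnitary : Matrix V V ℝ) *
        (hA.eigenvectorUnitary : Matrix V V ℝ).conjTranspose = 1 :=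
      Unitary.mul_star_self_of_mem hA.eigenvectorUnitary.2
    have h4 : Matrix.diagonal (fun i => specRad G - hA.eigenvalues i) =
        specRad G • (1 : Matrix V V ℝ) - Matrix.diagonal hA.eigenvalues := by
      rw [← Matrix.diagonal_one, ← Matrix.diagonal_smul, Matrix.diagonal_sub]
      congr 1; ext i; simp
    rw [h4, Matrix.mul_sub, Matrix.sub_mul, Matrix.mul_smul, Matrix.mul_one, Matrix.smul_mul, h3]
    congr 1
  rw [h1]
  apply Matrix.PosSemidef.mul_mul_conjTranspose_same
  apply Matrix.PosSemidef.diagonal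
  intro i
  exact sub_nonneg.2 (le_ciSup (Set.finite_range _).bddAbove i)

theorem rayleigh_le_specRad (G : SimpleGraph V) (y : V → ℝ) :
    ∑ v, y v * ∑ w, adjMat G v w * y w ≤ specRad G * ∑ v, y v * y v := by
  have h := (posSemidef_specRad_sub G).dotProduct_mulVec_nonneg y
  simp only [Matrix.sub_mulVec, Matrix.smul_mulVec, Matrix.one_mulVec, dotProduct_sub,
    dotProduct_smul, star_trivial] at h
  simpa [dotProduct, Matrix.mulVec] using h

theorem eigen_of_rayleigh_eq (G : SimpleGraph V) (y : V → ℝ)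
    (h : specRad G * ∑ v, y v * y v ≤ ∑ v, y v * ∑ w, adjMat G v w * y w) (v : V) :
    specRad G * y v = ∑ w, adjMat G v w * y w := by
  have h0 : star y ⬝ᵥ (specRad G • (1 : Matrix V V ℝ) - adjMat G).mulVec y = 0 := by
    simp only [Matrix.sub_mulVec, Matrix.smul_mulVec, Matrix.one_mulVec, dotProduct_sub,
      dotProduct_smul, star_trivial]
    have := le_antisymm h (rayleigh_le_specRad G y)
    simpa [dotProduct, Matrix.mulVec, sub_eq_zero] using this
  rw [(posSemidef_specRad_sub G).dotProduct_mulVec_zero_iff] at h0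
  rw [Matrix.sub_mulVec, Matrix.smul_mulVec, Matrix.one_mulVec, sub_eq_zero] at h0
  simpa [Matrix.mulVec, dotProduct] using congrFun h0 v

theorem exists_nonneg_eigenvector [Nonempty V] (G : SimpleGraph V) :
    ∃ y : V → ℝ, (∀ v, 0 ≤ y v) ∧ y ≠ 0 ∧
      ∀ v, specRad G * y v = ∑ w, adjMat G v w * y w := by
  have hA := adjMat_isHermitian G
  obtain ⟨i, hi⟩ := exists_eq_ciSup_of_finite (f := hA.eigenvalues)
  have hi : hA.eigenvalues i = specRad G := hi
  set f : V → ℝ := (hA.eigenvectorBasis i).ofLp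
  have hev : ∀ v, specRad G * f v = ∑ w, adjMat G v w * f w := fun v => by
    have := congrFun (hA.mulVec_eigenvectorBasis i) v
    rw [hi] at this
    simpa [Matrix.mulVec, dotProduct] using this.symm
  have hf0 : f ≠ 0 := by
    intro h
    have := hA.eigenvectorBasis.orthonormal.ne_zero i
    apply this
    ext v
    exact congrFun h v
  refine ⟨fun v => |f v|, fun v => abs_nonneg _, ?_, ?_⟩
  · intro h
    apply hf0
    ext v
    exact abs_eq_zero.1 (congrFun h v)
  · apply eigen_of_rayleigh_eq
    rw [Finset.mul_sum]
    apply Finset.sum_le_sum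
    intro v _
    rw [abs_mul_abs_self, ← mul_assoc, mul_comm (specRad G), mul_assoc, hev, Finset.mul_sum,
      Finset.mul_sum]
    apply Finset.sum_le_sum
    intro w _
    calc f v * (adjMat G v w * f w) ≤ |f v * (adjMat G v w * f w)| := le_abs_self _
      _ = _ := by rw [abs_mul, abs_mul, abs_of_nonneg (adjMat_nonneg G v w)]

end Spectral

/-- `x` is a positive eigenvector of `G` for `ρ`, scaled so that its maximal entry,
attained at `u`, is `1`. -/
structure IsScaledPerron {V : Type*} [Fintype V] (G : SimpleGraph V) (x : V → ℝ) (u : V) (ρ : ℝ) :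
    Prop where
  pos : ∀ v, 0 < x v
  le_one : ∀ v, x v ≤ 1
  eq_one : x u = 1
  eigen : ∀ v, ρ * x v = ∑ w, adjMat G v w * x w

theorem exists_isScaledPerron {V : Type*} [Fintype V] [DecidableEq V] (G : SimpleGraph V)
    (hG : G.Connected) : ∃ x u, IsScaledPerron G x u (specRad G) := by
  classical
  have := hG.nonempty
  obtain ⟨y, hy0, hy, hev⟩ := exists_nonneg_eigenvector G
  have hpos : ∀ v, 0 < y v := by
    by_contra! h
    obtain ⟨v, hv⟩ := h
    replace hv : y v = 0 := le_antisymm hv (hy0 v)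
    have hstep : ∀ a b, G.Adj a b → y a = 0 → y b = 0 := by
      intro a b hab ha
      have h1 := hev a
      rw [ha, mul_zero] at h1
      have h2 := (Finset.sum_eq_zero_iff_of_nonneg
        (fun w _ => mul_nonneg (adjMat_nonneg G a w) (hy0 w))).1 h1.symm b (Finset.mem_univ b)
      simpa [adjMat_apply, hab] using h2
    apply hy
    ext w
    obtain ⟨p⟩ := hG.preconnected v w
    induction p with
    | nil => exact hv
    | cons h p ih => exact ih (hstep _ _ h hv)
  obtain ⟨u, hu⟩ := Finite.exists_max y
  refine ⟨fun v => y v / y u, u, fun v => div_pos (hpos v) (hpos u),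
    fun v => (div_le_one (hpos u)).2 (hu v), div_self (hpos u).ne', fun v => ?_⟩
  simp only [← mul_div_assoc, hev v, Finset.sum_div]

theorem sum_adjMat {V : Type*} [Fintype V] [DecidableEq V] (G : SimpleGraph V) :
    ∑ v, ∑ w, adjMat G v w = 2 * (G.edgeSet.ncard : ℝ) := by
  classical
  have h := G.sum_degrees_eq_twice_card_edges
  rw [← SimpleGraph.coe_edgeFinset, Set.ncard_coe_finset]
  have h' : (∑ v, (G.degree v : ℝ)) = 2 * (#G.edgeFinset : ℝ) := by exact_mod_cast h
  rw [← h']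
  refine Finset.sum_congr rfl fun v _ => ?_
  simp [adjMat_apply, ← SimpleGraph.card_neighborFinset_eq_degree,
    SimpleGraph.neighborFinset_eq_filter]

theorem one_lt_specRad {V : Type*} [Fintype V] [DecidableEq V] (G : SimpleGraph V)
    (hG : G.Connected) (hm : 2 ≤ G.edgeSet.ncard) : 1 < specRad G := by
  have := hG.nonempty
  have h1 := rayleigh_le_specRad G (fun _ => 1)
  simp only [mul_one, one_mul, sum_adjMat, Finset.sum_const, Finset.card_univ, nsmul_eq_mul] at h1
  have h2 := hG.card_vert_le_card_edgeSet_add_one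
  rw [Nat.card_coe_set_eq, Nat.card_eq_fintype_card] at h2
  have h2' : (Fintype.card V : ℝ) ≤ G.edgeSet.ncard + 1 := by exact_mod_cast h2
  have h3 : (2 : ℝ) ≤ G.edgeSet.ncard := by exact_mod_cast hm
  by_contra! h
  have : (0 : ℝ) ≤ Fintype.card V := by positivity
  nlinarith

section Core

variable {V : Type*}

theorem adjMat_of_adj {G : SimpleGraph V} {v w : V} (h : G.Adj v w) : adjMat G v w = 1 := by
  classical
  simp [adjMat_apply, h]

theorem adjMat_of_not_adj {G : SimpleGraph V} {v w : V} (h : ¬ G.Adj v w) : adjMat G v w = 0 := by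
  classical
  simp [adjMat_apply, h]

theorem sum_mul_adjMat_comm (G : SimpleGraph V) (s t : Finset V) (f : V → V → ℝ) :
    ∑ v ∈ s, ∑ w ∈ t, adjMat G v w * f v w = ∑ w ∈ t, ∑ v ∈ s, adjMat G w v * f v w := by
  rw [Finset.sum_comm]
  simp only [adjMat_symm G]

/-- `r` bounds the number of common neighbors of any two adjacent vertices. -/
def BookBound (G : SimpleGraph V) (r : ℝ) : Prop :=
  ∀ v w, G.Adj v w → ∀ s : Finset V, (∀ q ∈ s, G.Adj v q ∧ G.Adj w q) → (#s : ℝ) ≤ r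

theorem BookBound.sum_le {G : SimpleGraph V} {r : ℝ} (hB : BookBound G r) {v w : V}
    (h : G.Adj v w) (s : Finset V) : ∑ z ∈ s, adjMat G v z * adjMat G w z ≤ r := by
  classical
  have h1 := hB v w h (s.filter fun z => G.Adj v z ∧ G.Adj w z)
    (fun q hq => (Finset.mem_filter.1 hq).2)
  refine le_trans (le_of_eq ?_) h1
  rw [Finset.card_filter]
  push_cast
  refine Finset.sum_congr rfl fun z _ => ?_
  by_cases h1 : G.Adj v z <;> by_cases h2 : G.Adj w z <;> simp [adjMat_apply, h1, h2]

theorem two_le_sum_adjMat_of_adj {G : SimpleGraph V} {s : Finset V} {z w : V} (hz : z ∈ s)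
    (hw : w ∈ s) (hzw : G.Adj z w) : 2 ≤ ∑ z ∈ s, ∑ z' ∈ s, adjMat G z z' := by
  classical
  have h1 : ∀ z ∈ s, ∀ w ∈ s, G.Adj z w → 1 ≤ ∑ z' ∈ s, adjMat G z z' :=
    fun z _ w hw hzw => by
      have := Finset.single_le_sum (f := fun z' => adjMat G z z')
        (fun z' _ => adjMat_nonneg G z z') hw
      simpa [adjMat_of_adj hzw] using this
  have h2 : ∑ z ∈ {z, w}, ∑ z' ∈ s, adjMat G z z' ≤ ∑ z ∈ s, ∑ z' ∈ s, adjMat G z z' :=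
    Finset.sum_le_sum_of_subset_of_nonneg (by simp [Finset.insert_subset_iff, hz, hw])
      fun z _ _ => Finset.sum_nonneg fun w _ => adjMat_nonneg G z w
  rw [Finset.sum_pair hzw.ne] at h2
  linarith [h1 z hz w hw hzw, h1 w hw z hz hzw.symm]

theorem sum_adjMat_mul_of_unique {G : SimpleGraph V} {s : Finset V} {p q : V} (hq : q ∈ s)
    (hpq : G.Adj p q) (huniq : ∀ w ∈ s, G.Adj p w → w = q) (g : V → ℝ) :
    ∑ w ∈ s, adjMat G p w * g w = g q := by
  rw [Finset.sum_eq_single_of_mem q hq, adjMat_of_adj hpq, one_mul]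
  intro w hw hne
  rw [adjMat_of_not_adj fun h => hne (huniq w hw h), zero_mul]

variable [Fintype V]

open scoped Classical in
/-- The neighbors of `u`. -/
noncomputable def nbhd (G : SimpleGraph V) (u : V) : Finset V :=
  univ.filter fun v => G.Adj u v

open scoped Classical in
/-- The vertices other than `u` that are not adjacent to `u`. -/
noncomputable def rest (G : SimpleGraph V) (u : V) : Finset V :=
  univ.filter fun v => v ≠ u ∧ ¬ G.Adj u v

theorem mem_nbhd {G : SimpleGraph V} {u v : V} : v ∈ nbhd G u ↔ G.Adj u v := by
  simp [nbhd]

theorem mem_rest {G : SimpleGraph V} {u v : V} : v ∈ rest G u ↔ v ≠ u ∧ ¬ G.Adj u v := by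
  simp [rest]

/-- The total `x`-weight of the vertices of `rest G u` not adjacent to `y`. -/
noncomputable def missing (G : SimpleGraph V) (x : V → ℝ) (u y : V) : ℝ :=
  ∑ z ∈ rest G u, (1 - adjMat G y z) * x z

theorem sum_univ_eq_root_add (G : SimpleGraph V) (u : V) (f : V → ℝ) :
    ∑ v, f v = f u + ∑ v ∈ nbhd G u, f v + ∑ v ∈ rest G u, f v := by
  classical
  have h1 : f u = ∑ v ∈ univ.filter (fun v => v = u), f v := by simp [Finset.sum_filter]
  rw [h1, nbhd, rest, Finset.sum_filter, Finset.sum_filter, Finset.sum_filter,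
    ← Finset.sum_add_distrib, ← Finset.sum_add_distrib]
  refine Finset.sum_congr rfl fun v _ => ?_
  by_cases hv : v = u
  · subst hv; simp
  · by_cases h : G.Adj u v <;> simp [hv, h]

theorem sum_adjMat_eq_split (G : SimpleGraph V) (u : V) :
    ∑ v, ∑ w, adjMat G v w = 2 * #(nbhd G u) +
      ∑ v ∈ nbhd G u, ∑ w ∈ nbhd G u, adjMat G v w +
    2 * ∑ z ∈ rest G u, ∑ v ∈ nbhd G u, adjMat G z v +
      ∑ z ∈ rest G u, ∑ z' ∈ rest G u, adjMat G z z' := by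
  have hu : ∑ w, adjMat G u w = #(nbhd G u) := by
    rw [sum_univ_eq_root_add G u, adjMat_of_not_adj (G.loopless.irrefl u),
      Finset.sum_congr rfl fun v hv => adjMat_of_adj (mem_nbhd.1 hv),
      Finset.sum_congr rfl fun v hv => adjMat_of_not_adj (mem_rest.1 hv).2]
    simp
  have hN : ∑ v ∈ nbhd G u, ∑ w, adjMat G v w = #(nbhd G u) +
      ∑ v ∈ nbhd G u, ∑ w ∈ nbhd G u, adjMat G v w +
      ∑ z ∈ rest G u, ∑ v ∈ nbhd G u, adjMat G z v := by
    have := sum_mul_adjMat_comm G (nbhd G u) (rest G u) (fun _ _ => 1)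
    simp only [mul_one] at this
    rw [← this, Finset.sum_congr rfl fun v hv => by
      rw [sum_univ_eq_root_add G u, adjMat_of_adj (mem_nbhd.1 hv).symm]]
    simp [Finset.sum_add_distrib]
  have hW : ∑ z ∈ rest G u, ∑ w, adjMat G z w =
      ∑ z ∈ rest G u, ∑ v ∈ nbhd G u, adjMat G z v +
      ∑ z ∈ rest G u, ∑ z' ∈ rest G u, adjMat G z z' := by
    rw [Finset.sum_congr rfl fun v hv => by
      rw [sum_univ_eq_root_add G u, adjMat_of_not_adj (fun h => (mem_rest.1 hv).2 h.symm),
        zero_add]]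
    simp [Finset.sum_add_distrib]
  rw [sum_univ_eq_root_add G u, hu, hN, hW]
  ring

theorem BookBound.sum_nbhd_le {G : SimpleGraph V} {r : ℝ} (hB : BookBound G r) {u y : V}
    (h : y ∈ nbhd G u) : ∑ v ∈ nbhd G u, adjMat G y v ≤ r := by
  refine le_trans (le_of_eq ?_) (hB.sum_le (mem_nbhd.1 h) (nbhd G u))
  refine Finset.sum_congr rfl fun v hv => ?_
  rw [adjMat_of_adj (mem_nbhd.1 hv), one_mul]

namespace IsScaledPerron

variable {G : SimpleGraph V} {x : V → ℝ} {u : V} {ρ r : ℝ}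

theorem eigen_root (h : IsScaledPerron G x u ρ) : ρ = ∑ v ∈ nbhd G u, x v := by
  have h1 := h.eigen u
  rw [sum_univ_eq_root_add G u, h.eq_one, mul_one, adjMat_of_not_adj (G.loopless.irrefl u)] at h1
  have h2 : ∑ v ∈ rest G u, adjMat G u v * x v = 0 :=
    Finset.sum_eq_zero fun v hv => by rw [adjMat_of_not_adj (mem_rest.1 hv).2, zero_mul]
  have h3 : ∑ v ∈ nbhd G u, adjMat G u v * x v = ∑ v ∈ nbhd G u, x v :=
    Finset.sum_congr rfl fun v hv => by rw [adjMat_of_adj (mem_nbhd.1 hv), one_mul]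
  linarith

theorem eigen_nbhd (h : IsScaledPerron G x u ρ) {y : V} (hy : y ∈ nbhd G u) :
    ρ * x y = 1 + ∑ w ∈ nbhd G u, adjMat G y w * x w + ∑ z ∈ rest G u, adjMat G y z * x z := by
  rw [h.eigen y, sum_univ_eq_root_add G u, h.eq_one,
    adjMat_of_adj (mem_nbhd.1 hy).symm, one_mul]

theorem eigen_rest (h : IsScaledPerron G x u ρ) {z : V} (hz : z ∈ rest G u) :
    ρ * x z = ∑ w ∈ nbhd G u, adjMat G z w * x w + ∑ z' ∈ rest G u, adjMat G z z' * x z' := by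
  rw [h.eigen z, sum_univ_eq_root_add G u, h.eq_one,
    adjMat_of_not_adj (fun h => (mem_rest.1 hz).2 h.symm), zero_mul, zero_add]

theorem missing_nonneg (h : IsScaledPerron G x u ρ) (y : V) : 0 ≤ missing G x u y :=
  Finset.sum_nonneg fun z _ =>
    mul_nonneg (sub_nonneg.2 (adjMat_le_one G y z)) (h.pos z).le

theorem gap_identity (h : IsScaledPerron G x u ρ) :
    (∑ v, ∑ w, adjMat G v w) / 2 - ρ ^ 2 =
      ∑ z ∈ rest G u, (∑ v ∈ nbhd G u, adjMat G z v) * (1 - x z) +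
      (∑ z ∈ rest G u, ∑ z' ∈ rest G u, adjMat G z z') / 2 +
      (∑ v ∈ nbhd G u, ∑ w ∈ nbhd G u, adjMat G v w * (1 - x v - x w)) / 2 := by
  have e2 : ρ ^ 2 = #(nbhd G u) + ∑ v ∈ nbhd G u, ∑ w ∈ nbhd G u, adjMat G v w * x w +
      ∑ z ∈ rest G u, ∑ v ∈ nbhd G u, adjMat G z v * x z := by
    rw [← sum_mul_adjMat_comm G (nbhd G u) (rest G u) (fun _ z => x z)]
    have : ρ ^ 2 = ∑ v ∈ nbhd G u, ρ * x v := by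
      rw [← Finset.mul_sum, ← h.eigen_root]; ring
    rw [this, Finset.sum_congr rfl fun v hv => h.eigen_nbhd hv]
    simp [Finset.sum_add_distrib]
  have e3 : ∑ v ∈ nbhd G u, ∑ w ∈ nbhd G u, adjMat G v w * (1 - x v - x w) =
      ∑ v ∈ nbhd G u, ∑ w ∈ nbhd G u, adjMat G v w -
      2 * ∑ v ∈ nbhd G u, ∑ w ∈ nbhd G u, adjMat G v w * x w := by
    have := sum_mul_adjMat_comm G (nbhd G u) (nbhd G u) (fun v _ => x v)
    simp only [mul_sub, mul_one, Finset.sum_sub_distrib, this]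
    ring
  have e4 : ∑ z ∈ rest G u, (∑ v ∈ nbhd G u, adjMat G z v) * (1 - x z) =
      ∑ z ∈ rest G u, ∑ v ∈ nbhd G u, adjMat G z v -
      ∑ z ∈ rest G u, ∑ v ∈ nbhd G u, adjMat G z v * x z := by
    simp only [mul_sub, mul_one, Finset.sum_sub_distrib, Finset.sum_mul]
  rw [sum_adjMat_eq_split G u, e2, e3, e4]
  ring

theorem sum_missing_eq (h : IsScaledPerron G x u ρ) :
    ∑ y ∈ nbhd G u, x y * missing G x u y =
      ∑ z ∈ rest G u, x z * (ρ - ∑ v ∈ nbhd G u, adjMat G z v * x v) := by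
  simp only [missing, Finset.mul_sum]
  rw [Finset.sum_comm]
  refine Finset.sum_congr rfl fun z _ => ?_
  rw [h.eigen_root, ← Finset.sum_sub_distrib, Finset.mul_sum]
  refine Finset.sum_congr rfl fun v _ => ?_
  rw [adjMat_symm G v z]; ring

theorem sum_adjMat_mul_le (h : IsScaledPerron G x u ρ) (s : Finset V) (z : V) :
    ∑ v ∈ s, adjMat G z v * x v ≤ ∑ v ∈ s, adjMat G z v :=
  Finset.sum_le_sum fun v _ =>
    mul_le_of_le_one_right (adjMat_nonneg G z v) (h.le_one v)

theorem sum_adjMat_mul_nonneg (h : IsScaledPerron G x u ρ) (s : Finset V) (z : V) :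
    0 ≤ ∑ v ∈ s, adjMat G z v * x v :=
  Finset.sum_nonneg fun v _ => mul_nonneg (adjMat_nonneg G z v) (h.pos v).le

theorem sum_missing_le (h : IsScaledPerron G x u ρ) :
    ∑ y ∈ nbhd G u, x y * missing G x u y ≤
      ∑ z ∈ rest G u, (∑ v ∈ nbhd G u, adjMat G z v) * (1 - x z) +
      ∑ z ∈ rest G u, ∑ z' ∈ rest G u, adjMat G z z' * x z' := by
  rw [h.sum_missing_eq, ← Finset.sum_add_distrib]
  refine Finset.sum_le_sum fun z hz => ?_
  have h1 := h.sum_adjMat_mul_le (nbhd G u) z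
  have h2 := h.eigen_rest hz
  have h3 := h.le_one z
  nlinarith [mul_le_mul_of_nonneg_right h1 (sub_nonneg.2 h3)]

theorem cost_nonneg (h : IsScaledPerron G x u ρ) (z : V) :
    0 ≤ (∑ v ∈ nbhd G u, adjMat G z v) * (1 - x z) :=
  mul_nonneg (Finset.sum_nonneg fun v _ => adjMat_nonneg G z v) (sub_nonneg.2 (h.le_one z))

theorem missing_ge (h : IsScaledPerron G x u ρ) (hr : 1 ≤ r) (hB : BookBound G r) {y w : V}
    (hw : w ∈ nbhd G u) (hyw : G.Adj y w) :
    ρ * x w - 3 * r ≤ missing G x u y := by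
  have h1 : ∑ z ∈ rest G u, adjMat G w z * x z -
      ∑ z ∈ rest G u, adjMat G y z * adjMat G w z ≤ missing G x u y := by
    rw [missing, ← Finset.sum_sub_distrib]
    refine Finset.sum_le_sum fun z _ => ?_
    have hp := h.pos z
    have hl := h.le_one z
    classical
    by_cases h1 : G.Adj y z <;> by_cases h2 : G.Adj w z <;> simp [adjMat_apply, h1, h2] <;> linarith
  have h2 := hB.sum_le hyw (rest G u)
  have h3 := h.eigen_nbhd hw
  have h4 := (h.sum_adjMat_mul_le (nbhd G u) w).trans (hB.sum_nbhd_le hw)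
  linarith

end IsScaledPerron

/-- `R` orients every pair of distinct vertices towards an end of larger weight. -/
structure IsOrientation (x : V → ℝ) (R : V → V → Prop) : Prop where
  iff_not : ∀ v w, v ≠ w → (R v w ↔ ¬ R w v)
  le : ∀ v w, R v w → x v ≤ x w

theorem exists_isOrientation (x : V → ℝ) : ∃ R, IsOrientation x R := by
  let e := Fintype.equivFin V
  refine ⟨fun v w => x v < x w ∨ (x v = x w ∧ e v < e w), ⟨fun v w hvw => ?_, fun v w hvw => ?_⟩⟩
  · have hne : e v ≠ e w := fun h => hvw (e.injective h)
    rcases lt_trichotomy (x v) (x w) with h | h | h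
    · simp [h, h.not_gt, h.ne']
    · simp only [h, lt_irrefl, true_and, false_or, not_lt]
      exact ⟨le_of_lt, fun h => lt_of_le_of_ne h hne⟩
    · simp [h, h.not_gt, h.ne']
  · rcases hvw with h | h
    · exact h.le
    · exact h.1.le

open scoped Classical in
/-- The neighbors `w` of `y` in the neighborhood of `u` for which `y w` is oriented to `w`. -/
noncomputable def outNbrs (G : SimpleGraph V) (u : V) (R : V → V → Prop) (y : V) : Finset V :=
  (nbhd G u).filter fun w => G.Adj y w ∧ R y w

theorem mem_outNbrs {G : SimpleGraph V} {u y w : V} {R : V → V → Prop} :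
    w ∈ outNbrs G u R y ↔ w ∈ nbhd G u ∧ G.Adj y w ∧ R y w := by
  simp [outNbrs]

theorem IsOrientation.sum_eq {G : SimpleGraph V} {x : V → ℝ} {R : V → V → Prop}
    (hR : IsOrientation x R) (u : V) (f : V → V → ℝ) (hf : ∀ v w, f v w = f w v) :
    (∑ v ∈ nbhd G u, ∑ w ∈ nbhd G u, adjMat G v w * f v w) / 2 =
      ∑ v ∈ nbhd G u, ∑ w ∈ outNbrs G u R v, f v w := by
  classical
  have h1 : ∀ v w, adjMat G v w * f v w =
      (if G.Adj v w ∧ R v w then f v w else 0) + (if G.Adj w v ∧ R w v then f w v else 0) := by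
    intro v w
    by_cases h : G.Adj v w
    · have h2 := hR.iff_not v w h.ne
      by_cases h3 : R w v
      · simp [adjMat_apply, h, h.symm, h2, h3, hf v w]
      · simp [adjMat_apply, h, h.symm, h2, h3]
    · have h' : ¬ G.Adj w v := fun hh => h hh.symm
      simp [adjMat_apply, h, h']
  have h2 : ∑ v ∈ nbhd G u, ∑ w ∈ nbhd G u, (if G.Adj w v ∧ R w v then f w v else 0) =
      ∑ v ∈ nbhd G u, ∑ w ∈ nbhd G u, (if G.Adj v w ∧ R v w then f v w else 0) :=
    Finset.sum_comm
  simp only [h1, Finset.sum_add_distrib]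
  rw [h2, add_self_div_two]
  refine Finset.sum_congr rfl fun v _ => ?_
  rw [outNbrs, Finset.sum_filter]

namespace IsScaledPerron

variable {G : SimpleGraph V} {x : V → ℝ} {u : V} {ρ r : ℝ} {R : V → V → Prop}

theorem outNbrs_dichotomy (h : IsScaledPerron G x u ρ) (hr : 1 ≤ r) (hB : BookBound G r)
    (hρ : 239 * r ≤ ρ) (hR : IsOrientation x R) {y : V} (hy : y ∈ nbhd G u) :
    (#(outNbrs G u R y) : ℝ) / 2 ≤ ∑ w ∈ outNbrs G u R y, (1 - x y - x w) ∨
      (1 ≤ ∑ w ∈ outNbrs G u R y, (1 - x y - x w) + x y * missing G x u y ∧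
      4 / 5 ≤ ∑ w ∈ outNbrs G u R y, (1 - x y - x w) + 1 / 2 * (x y * missing G x u y) ∧
      2 / 5 ≤ ∑ w ∈ outNbrs G u R y, (1 - x y - x w) + 1 / 4 * (x y * missing G x u y)) := by
  classical
  rcases (outNbrs G u R y).eq_empty_or_nonempty with h0 | hne
  · left; simp [h0]
  obtain ⟨w, hw, hmax⟩ := Finset.exists_max_image (outNbrs G u R y) x hne
  obtain ⟨hwN, hyw, hRyw⟩ := mem_outNbrs.1 hw
  have hyt := hR.le y w hRyw
  have hy0 := h.pos y
  by_cases ht : x w < 1 / 4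
  · left
    have : ∑ _w' ∈ outNbrs G u R y, (1 / 2 : ℝ) ≤ ∑ w ∈ outNbrs G u R y, (1 - x y - x w) :=
      Finset.sum_le_sum fun w' hw' => by linarith [hmax w' hw']
    simp only [Finset.sum_const, nsmul_eq_mul] at this
    linarith
  right
  push Not at ht
  have ht1 := h.le_one w
  have hM := h.missing_ge hr hB hwN hyw
  have hcard : (#(outNbrs G u R y) : ℝ) ≤ r := hB u y (mem_nbhd.1 hy) _ fun q hq =>
    ⟨mem_nbhd.1 (mem_outNbrs.1 hq).1, (mem_outNbrs.1 hq).2.1⟩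
  have hc : 1 - x w - r * x y ≤ ∑ w ∈ outNbrs G u R y, (1 - x y - x w) := by
    have h1 : ∑ _w' ∈ (outNbrs G u R y).erase w, (-x y) ≤
        ∑ w' ∈ (outNbrs G u R y).erase w, (1 - x y - x w') :=
      Finset.sum_le_sum fun w' _ => by linarith [h.le_one w']
    have h2 := Finset.add_sum_erase (outNbrs G u R y) (fun w' => 1 - x y - x w') hw
    have h3 : ((#((outNbrs G u R y).erase w) : ℕ) : ℝ) = #(outNbrs G u R y) - 1 := by
      rw [Finset.card_erase_of_mem hw, Nat.cast_sub (Finset.card_pos.2 hne), Nat.cast_one]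
    simp only [Finset.sum_const, nsmul_eq_mul, h3] at h1
    nlinarith
  have hylow : 1 + x w ≤ ρ * x y := by
    rw [h.eigen_nbhd hy]
    have h1 := Finset.single_le_sum (f := fun w => adjMat G y w * x w)
      (fun w _ => mul_nonneg (adjMat_nonneg G y w) (h.pos w).le) hwN
    have h2 := h.sum_adjMat_mul_nonneg (rest G u) y
    simp only [adjMat_of_adj hyw, one_mul] at h1
    linarith
  have key : ∀ l : ℝ, 1 / 4 ≤ l → l ≤ 1 →
      1 - x w + (1 + x w) * (l * x w - (3 * l + 1) / 239) ≤
        ∑ w ∈ outNbrs G u R y, (1 - x y - x w) + l * (x y * missing G x u y) := by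
    intro l hl hl1
    have h1 : l * (x y * (ρ * x w - 3 * r)) ≤ l * (x y * missing G x u y) :=
      mul_le_mul_of_nonneg_left (mul_le_mul_of_nonneg_left hM hy0.le) (by linarith)
    have h2 : x y * (r * (3 * l + 1)) ≤ x y * (ρ * ((3 * l + 1) / 239)) :=
      mul_le_mul_of_nonneg_left (by nlinarith) hy0.le
    have h3 : 0 ≤ l * x w - (3 * l + 1) / 239 := by nlinarith
    have h4 := mul_le_mul_of_nonneg_right hylow h3
    nlinarith
  refine ⟨?_, ?_, ?_⟩
  · have := key 1 (by norm_num) le_rfl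
    nlinarith
  · have := key (1 / 2) (by norm_num) (by norm_num)
    nlinarith [sq_nonneg (x w - 1 / 2)]
  · have := key (1 / 4) (by norm_num) (by norm_num)
    nlinarith [sq_nonneg (x w - 1)]

theorem add_le_of_adj_rest (h : IsScaledPerron G x u ρ) (hB : BookBound G r) {z w : V}
    (hz : z ∈ rest G u) (hw : w ∈ rest G u) (hzw : G.Adj z w) :
    ρ * (x z + x w) ≤ ρ + r + 2 * ∑ z ∈ rest G u, ∑ z' ∈ rest G u, adjMat G z z' := by
  have h1 : ∑ v ∈ nbhd G u, adjMat G z v * x v + ∑ v ∈ nbhd G u, adjMat G w v * x v -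
      ∑ v ∈ nbhd G u, adjMat G z v * adjMat G w v ≤ ρ := by
    conv_rhs => rw [h.eigen_root]
    rw [← Finset.sum_add_distrib, ← Finset.sum_sub_distrib]
    refine Finset.sum_le_sum fun v _ => ?_
    have hp := h.pos v
    have hl := h.le_one v
    classical
    by_cases h1 : G.Adj z v <;> by_cases h2 : G.Adj w v <;> simp [adjMat_apply, h1, h2] <;> linarith
  have h2 := hB.sum_le hzw (nbhd G u)
  have h3 : ∀ z ∈ rest G u, ∑ z' ∈ rest G u, adjMat G z z' * x z' ≤
      ∑ z ∈ rest G u, ∑ z' ∈ rest G u, adjMat G z z' := fun z hz =>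
    (h.sum_adjMat_mul_le (rest G u) z).trans
      (Finset.single_le_sum (f := fun z => ∑ z' ∈ rest G u, adjMat G z z')
        (fun z _ => Finset.sum_nonneg fun w _ => adjMat_nonneg G z w) hz)
  have h4 := h3 z hz
  have h5 := h3 w hw
  rw [mul_add, h.eigen_rest hz, h.eigen_rest hw]
  linarith

theorem rest_sum_le (h : IsScaledPerron G x u ρ) (hr : 1 ≤ r) (hB : BookBound G r)
    (hρ : 239 * r ≤ ρ) (hE : ∑ z ∈ rest G u, ∑ z' ∈ rest G u, adjMat G z z' ≤ 3) :
    ∑ z ∈ rest G u, ∑ z' ∈ rest G u, adjMat G z z' * x z' ≤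
      3 / 4 * ∑ z ∈ rest G u, ∑ z' ∈ rest G u, adjMat G z z' := by
  have h1 := sum_mul_adjMat_comm G (rest G u) (rest G u) (fun z _ => x z)
  have h2 : ∑ z ∈ rest G u, ∑ z' ∈ rest G u, (adjMat G z z' * x z + adjMat G z z' * x z') ≤
      ∑ z ∈ rest G u, ∑ z' ∈ rest G u, 3 / 2 * adjMat G z z' := by
    refine Finset.sum_le_sum fun z hz => Finset.sum_le_sum fun w hw => ?_
    by_cases hzw : G.Adj z w
    · have h3 := h.add_le_of_adj_rest hB hz hw hzw
      rw [adjMat_of_adj hzw]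
      nlinarith
    · simp [adjMat_of_not_adj hzw]
  simp only [Finset.sum_add_distrib, ← Finset.mul_sum] at h2
  linarith

theorem structure_of_gap (h : IsScaledPerron G x u ρ) (hr : 1 ≤ r) (hB : BookBound G r)
    (hρ : 239 * r ≤ ρ) (hR : IsOrientation x R) (hgap : (∑ v, ∑ w, adjMat G v w) / 2 - ρ ^ 2 < 1) :
    (∑ z ∈ rest G u, ∑ z' ∈ rest G u, adjMat G z z' < 2) ∧
      ∑ v ∈ nbhd G u, #(outNbrs G u R v) ≤ 1 := by
  rw [h.gap_identity, hR.sum_eq u (fun v w => 1 - x v - x w) (fun v w => by ring)] at hgap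
  have hdich := fun y (hy : y ∈ nbhd G u) => h.outNbrs_dichotomy hr hB hρ hR hy
  have hP := h.sum_missing_le
  have hC : 0 ≤ ∑ z ∈ rest G u, (∑ v ∈ nbhd G u, adjMat G z v) * (1 - x z) :=
    Finset.sum_nonneg fun z _ => h.cost_nonneg z
  have hE : 0 ≤ ∑ z ∈ rest G u, ∑ z' ∈ rest G u, adjMat G z z' :=
    Finset.sum_nonneg fun z _ => Finset.sum_nonneg fun w _ => adjMat_nonneg G z w
  have hS : ∑ z ∈ rest G u, ∑ z' ∈ rest G u, adjMat G z z' * x z' ≤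
      ∑ z ∈ rest G u, ∑ z' ∈ rest G u, adjMat G z z' :=
    Finset.sum_le_sum fun z _ => h.sum_adjMat_mul_le _ z
  have hS' := h.rest_sum_le hr hB hρ
  have hS0 : ∑ z ∈ rest G u, ∑ z' ∈ rest G u, adjMat G z z' < 2 →
      ∑ z ∈ rest G u, ∑ z' ∈ rest G u, adjMat G z z' * x z' = 0 := fun hlt =>
    Finset.sum_eq_zero fun z hz => Finset.sum_eq_zero fun w hw => by
      rw [adjMat_of_not_adj fun hzw => hlt.not_ge (two_le_sum_adjMat_of_adj hz hw hzw), zero_mul]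
  have hxM : ∀ y, 0 ≤ x y * missing G x u y := fun y =>
    mul_nonneg (h.pos y).le (h.missing_nonneg y)
  by_cases hweak : ∀ y ∈ nbhd G u,
      (#(outNbrs G u R y) : ℝ) / 2 ≤ ∑ w ∈ outNbrs G u R y, (1 - x y - x w)
  · have hK := Finset.sum_le_sum hweak
    rw [← Finset.sum_div] at hK
    have hcard : (0 : ℝ) ≤ ∑ v ∈ nbhd G u, (#(outNbrs G u R v) : ℝ) := by positivity
    refine ⟨by linarith, ?_⟩
    have : ∑ v ∈ nbhd G u, (#(outNbrs G u R v) : ℝ) < 2 := by linarith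
    have : ∑ v ∈ nbhd G u, #(outNbrs G u R v) < 2 := by exact_mod_cast this
    omega
  · exfalso
    push Not at hweak
    obtain ⟨y, hy, hlt⟩ := hweak
    obtain ⟨hs1, hs2, hs4⟩ := (hdich y hy).resolve_left hlt.not_ge
    have hnn : ∀ l : ℝ, 1 / 4 ≤ l → ∀ v ∈ nbhd G u,
        0 ≤ ∑ w ∈ outNbrs G u R v, (1 - x v - x w) + l * (x v * missing G x u v) := by
      intro l hl v hv
      rcases hdich v hv with h1 | h1
      · have : (0 : ℝ) ≤ (#(outNbrs G u R v) : ℝ) / 2 := by positivity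
        nlinarith [hxM v]
      · nlinarith [hxM v]
    have hsum : ∀ l : ℝ, 1 / 4 ≤ l →
        ∑ w ∈ outNbrs G u R y, (1 - x y - x w) + l * (x y * missing G x u y) ≤
        ∑ v ∈ nbhd G u, ∑ w ∈ outNbrs G u R v, (1 - x v - x w) +
          l * ∑ v ∈ nbhd G u, x v * missing G x u v := by
      intro l hl
      rw [Finset.mul_sum, ← Finset.sum_add_distrib]
      exact Finset.single_le_sum (f := fun v =>
        ∑ w ∈ outNbrs G u R v, (1 - x v - x w) + l * (x v * missing G x u v)) (hnn l hl) hy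
    have k1 := hsum 1 (by norm_num)
    have k2 := hsum (1 / 2) (by norm_num)
    have k4 := hsum (1 / 4) (by norm_num)
    have b4 : ∑ z ∈ rest G u, ∑ z' ∈ rest G u, adjMat G z z' ≤ 3 := by linarith
    have b2 : ∑ z ∈ rest G u, ∑ z' ∈ rest G u, adjMat G z z' < 2 := by linarith [hS' b4]
    have b1 := hS0 b2
    linarith

end IsScaledPerron

/-- `p q` is the only edge of `G` with both ends in the neighborhood of `u`, and there is no
edge with both ends in `rest G u`. -/
structure HasUniqueInnerEdge (G : SimpleGraph V) (u p q : V) : Prop where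
  left_mem : p ∈ nbhd G u
  right_mem : q ∈ nbhd G u
  adj : G.Adj p q
  unique : ∀ v ∈ nbhd G u, ∀ w ∈ nbhd G u, G.Adj v w → v = p ∧ w = q ∨ v = q ∧ w = p
  rest_not_adj : ∀ z ∈ rest G u, ∀ w ∈ rest G u, ¬ G.Adj z w

namespace HasUniqueInnerEdge

variable {G : SimpleGraph V} {u p q : V}

theorem symm (hE : HasUniqueInnerEdge G u p q) : HasUniqueInnerEdge G u q p :=
  ⟨hE.right_mem, hE.left_mem, hE.adj.symm, fun v hv w hw h => (hE.unique v hv w hw h).symm,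
    hE.rest_not_adj⟩

theorem sum_left (hE : HasUniqueInnerEdge G u p q) (g : V → ℝ) :
    ∑ w ∈ nbhd G u, adjMat G p w * g w = g q :=
  sum_adjMat_mul_of_unique hE.right_mem hE.adj (fun w hw h => by
    rcases hE.unique p hE.left_mem w hw h with h1 | h1
    · exact h1.2
    · exact absurd h1.1 hE.adj.ne) g

theorem sum_sum (hE : HasUniqueInnerEdge G u p q) (f : V → V → ℝ) :
    ∑ v ∈ nbhd G u, ∑ w ∈ nbhd G u, adjMat G v w * f v w = f p q + f q p := by
  classical
  have h1 : ∑ v ∈ {p, q}, ∑ w ∈ nbhd G u, adjMat G v w * f v w =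
      ∑ v ∈ nbhd G u, ∑ w ∈ nbhd G u, adjMat G v w * f v w := by
    refine Finset.sum_subset
      (by simp [Finset.insert_subset_iff, hE.left_mem, hE.right_mem]) fun v hv hne => ?_
    refine Finset.sum_eq_zero fun w hw => ?_
    rw [adjMat_of_not_adj, zero_mul]
    intro h
    rcases hE.unique v hv w hw h with h1 | h1 <;> simp [h1.1] at hne
  rw [← h1, Finset.sum_pair hE.adj.ne, hE.sum_left, hE.symm.sum_left]

theorem rest_sum (hE : HasUniqueInnerEdge G u p q) {z : V} (hz : z ∈ rest G u) (g : V → ℝ) :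
    ∑ w ∈ rest G u, adjMat G z w * g w = 0 :=
  Finset.sum_eq_zero fun w hw => by
    rw [adjMat_of_not_adj (hE.rest_not_adj z hz w hw), zero_mul]

end HasUniqueInnerEdge

namespace IsScaledPerron

variable {G : SimpleGraph V} {x : V → ℝ} {u p q : V} {ρ r : ℝ}

theorem eigen_left (h : IsScaledPerron G x u ρ) (hE : HasUniqueInnerEdge G u p q) :
    ρ * x p = 1 + x q + ∑ z ∈ rest G u, adjMat G p z * x z := by
  rw [h.eigen_nbhd hE.left_mem, hE.sum_left]

theorem eigen_rest_of_unique (h : IsScaledPerron G x u ρ) (hE : HasUniqueInnerEdge G u p q)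
    {z : V} (hz : z ∈ rest G u) : ρ * x z = ∑ w ∈ nbhd G u, adjMat G z w * x w := by
  rw [h.eigen_rest hz, hE.rest_sum hz, add_zero]

theorem le_defect (h : IsScaledPerron G x u ρ) (hE : HasUniqueInnerEdge G u p q)
    {z v : V} (hz : z ∈ rest G u) (hv : v ∈ nbhd G u) (hvz : ¬ G.Adj v z) :
    x v ≤ ρ * (1 - x z) := by
  have h1 : ρ * (1 - x z) = ∑ w ∈ nbhd G u, (1 - adjMat G z w) * x w := by
    simp only [sub_mul, one_mul, Finset.sum_sub_distrib]
    rw [← h.eigen_root, ← h.eigen_rest_of_unique hE hz]; ring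
  rw [h1]
  have := Finset.single_le_sum (f := fun w => (1 - adjMat G z w) * x w)
    (fun w _ => mul_nonneg (sub_nonneg.2 (adjMat_le_one G z w)) (h.pos w).le) hv
  simpa [adjMat_of_not_adj fun h => hvz h.symm] using this

theorem one_le_degree (h : IsScaledPerron G x u ρ) (hρ : 0 < ρ) (hE : HasUniqueInnerEdge G u p q)
    {z : V} (hz : z ∈ rest G u) : 1 ≤ ∑ v ∈ nbhd G u, adjMat G z v := by
  by_contra! hlt
  have h1 : ∀ v ∈ nbhd G u, ¬ G.Adj z v := fun v hv hzv => by
    have := Finset.single_le_sum (f := fun v => adjMat G z v)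
      (fun w _ => adjMat_nonneg G z w) hv
    simp only [adjMat_of_adj hzv] at this
    linarith
  have h2 := h.eigen_rest_of_unique hE hz
  rw [Finset.sum_eq_zero fun v hv => by rw [adjMat_of_not_adj (h1 v hv), zero_mul]] at h2
  have := mul_pos hρ (h.pos z)
  linarith

/-- In the weight of a vertex `z` of `rest G u` not adjacent to `p`, the loss caused by the
missing pair exceeds the contribution of `z` to the weight of the inner edge. -/
theorem lt_defect (h : IsScaledPerron G x u ρ) (hρ : 1 < ρ) (hE : HasUniqueInnerEdge G u p q)
    {z : V} (hz : z ∈ rest G u) (hpz : ¬ G.Adj p z) {T : ℝ} (hT0 : 0 ≤ T)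
    (hT : T ≤ ∑ z ∈ rest G u, adjMat G p z * x z) :
    adjMat G q z * (1 / (ρ - 1)) + T / ρ < ρ * (1 - x z) := by
  refine lt_of_lt_of_le ?_ (h.le_defect hE hz hE.left_mem hpz)
  have h1 := h.eigen_left hE
  have h2 := h.eigen_left hE.symm
  have hz0 := h.pos z
  have hq0 := h.pos q
  have hρ1 : 0 < ρ - 1 := by linarith
  have hxp : x p = ρ * x p / ρ := by field_simp
  by_cases hqz : G.Adj q z
  · have h3 := Finset.single_le_sum (f := fun z => adjMat G q z * x z)
      (fun w _ => mul_nonneg (adjMat_nonneg G q w) (h.pos w).le) hz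
    simp only [adjMat_of_adj hqz, one_mul] at h3
    rw [adjMat_of_adj hqz, one_mul]
    have h4 : 1 < (ρ - 1) * x q := by
      have : (ρ + 1) * 1 < (ρ + 1) * ((ρ - 1) * x q) := by nlinarith
      exact lt_of_mul_lt_mul_left this (by linarith)
    have h5 : 1 / (ρ - 1) < x q := by rw [div_lt_iff₀ hρ1]; linarith
    have h6 : 1 / (ρ - 1) = (1 + 1 / (ρ - 1)) / ρ := by field_simp; ring
    rw [h6, hxp, ← add_div]
    exact div_lt_div_of_pos_right (by linarith) (by linarith)
  · rw [adjMat_of_not_adj hqz, zero_mul, zero_add, hxp]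
    exact div_lt_div_of_pos_right (by linarith) (by linarith)

theorem cost_le (h : IsScaledPerron G x u ρ) (hρ : 1 < ρ) (hE : HasUniqueInnerEdge G u p q)
    (hgap : (∑ v, ∑ w, adjMat G v w) / 2 - ρ ^ 2 ≤ 1 - 2 / (ρ - 1)) :
    ∑ z ∈ rest G u, (∑ v ∈ nbhd G u, adjMat G z v) * (1 - x z) ≤
      ∑ z ∈ rest G u, (adjMat G p z + adjMat G q z) * x z * (1 / (ρ - 1)) := by
  have hW : ∑ z ∈ rest G u, ∑ z' ∈ rest G u, adjMat G z z' = 0 :=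
    Finset.sum_eq_zero fun z hz => by simpa using hE.rest_sum hz fun _ => 1
  rw [h.gap_identity, hW, hE.sum_sum fun v w => 1 - x v - x w] at hgap
  rw [← Finset.sum_mul]
  simp only [add_mul, Finset.sum_add_distrib]
  have h1 := h.eigen_left hE
  have h2 := h.eigen_left hE.symm
  have hρ1 : ρ - 1 ≠ 0 := by linarith
  have h3 : x p + x q - 2 / (ρ - 1) = (∑ z ∈ rest G u, adjMat G p z * x z +
      ∑ z ∈ rest G u, adjMat G q z * x z) * (1 / (ρ - 1)) := by
    field_simp
    linarith
  linarith

theorem adj_of_gap (h : IsScaledPerron G x u ρ) (hr : 1 ≤ r) (hB : BookBound G r)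
    (hρ : 239 * r ≤ ρ) (hE : HasUniqueInnerEdge G u p q)
    (hgap : (∑ v, ∑ w, adjMat G v w) / 2 - ρ ^ 2 ≤ 1 - 2 / (ρ - 1))
    {v z : V} (hv : v ∈ nbhd G u) (hz : z ∈ rest G u) : G.Adj v z := by
  classical
  by_contra hvz
  have hρ0 : 0 < ρ := by linarith
  have hρ1 : 0 < ρ - 1 := by linarith
  set μ := 1 / (ρ - 1) with hμ
  have hμ0 : 0 < μ := by positivity
  have hμr : r * μ ≤ 1 / 238 := by
    rw [hμ, mul_one_div, div_le_iff₀ hρ1]; linarith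
  have hμρ : ρ * μ ≤ 239 / 238 := by
    rw [hμ, mul_one_div, div_le_iff₀ hρ1]; linarith
  set cost : V → ℝ := fun z => (∑ v ∈ nbhd G u, adjMat G z v) * (1 - x z) with hcost
  have hcost0 : ∀ z, 0 ≤ cost z := h.cost_nonneg
  have hC : ∑ z ∈ rest G u, cost z ≤ ∑ z ∈ rest G u, (adjMat G p z + adjMat G q z) * x z * μ :=
    h.cost_le (by linarith) hE hgap
  set B := (rest G u).filter fun z => G.Adj p z ∧ G.Adj q z with hBdef
  set D := (rest G u).filter fun z => ¬ (G.Adj p z ∧ G.Adj q z) with hDdef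
  set T := ∑ z ∈ B, x z with hTdef
  have hT0 : 0 ≤ T := Finset.sum_nonneg fun z _ => (h.pos z).le
  have hBr : (#B : ℝ) ≤ r := hB p q hE.adj B fun z hz => (Finset.mem_filter.1 hz).2
  have hTr : T ≤ r := by
    have : T ≤ ∑ z ∈ B, (1 : ℝ) := Finset.sum_le_sum fun z _ => h.le_one z
    simp only [Finset.sum_const, nsmul_eq_mul, mul_one] at this
    linarith
  have hTle : ∀ a, (∀ z ∈ B, G.Adj a z) → T ≤ ∑ z ∈ rest G u, adjMat G a z * x z := by
    intro a ha
    calc T = ∑ z ∈ B, adjMat G a z * x z :=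
          Finset.sum_congr rfl fun z hz => by rw [adjMat_of_adj (ha z hz), one_mul]
      _ ≤ _ := Finset.sum_le_sum_of_subset_of_nonneg (Finset.filter_subset _ _)
          fun z _ _ => mul_nonneg (adjMat_nonneg G a z) (h.pos z).le
  have hTp := hTle p fun z hz => (Finset.mem_filter.1 hz).2.1
  have hTq := hTle q fun z hz => (Finset.mem_filter.1 hz).2.2
  have hdeg : ∀ z ∈ rest G u, ρ * x z ≤ ∑ v ∈ nbhd G u, adjMat G z v := fun z hz => by
    rw [h.eigen_rest_of_unique hE hz]; exact h.sum_adjMat_mul_le _ z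
  have hD : ∀ z ∈ D, (adjMat G p z + adjMat G q z) * x z * μ + x z * (T / ρ) < cost z := by
    intro z hz
    obtain ⟨hzW, hz⟩ := Finset.mem_filter.1 hz
    have hxz := h.pos z
    have h1 : (adjMat G p z + adjMat G q z) * μ + T / ρ < ρ * (1 - x z) := by
      by_cases hpz : G.Adj p z
      · have hqz : ¬ G.Adj q z := fun hqz => hz ⟨hpz, hqz⟩
        have := h.lt_defect (by linarith) hE.symm hzW hqz hT0 hTq
        rwa [adjMat_of_not_adj hqz, add_zero]
      · have := h.lt_defect (by linarith) hE hzW hpz hT0 hTp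
        rwa [adjMat_of_not_adj hpz, zero_add]
    have h2 := mul_le_mul_of_nonneg_right (hdeg z hzW) (sub_nonneg.2 (h.le_one z))
    have h3 := mul_lt_mul_of_pos_left h1 hxz
    simp only [hcost]
    linarith
  have hsplit : ∀ f : V → ℝ, ∑ z ∈ rest G u, f z = ∑ z ∈ B, f z + ∑ z ∈ D, f z := fun f =>
    (Finset.sum_filter_add_sum_filter_not _ _ _).symm
  have hBsum : ∑ z ∈ B, (adjMat G p z + adjMat G q z) * x z * μ = 2 * μ * T := by
    rw [hTdef, Finset.mul_sum]
    refine Finset.sum_congr rfl fun z hz => ?_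
    obtain ⟨_, h1, h2⟩ := Finset.mem_filter.1 hz
    rw [adjMat_of_adj h1, adjMat_of_adj h2]; ring
  have hC' := hC
  rw [hsplit, hsplit, hBsum] at hC'
  have hCB : 0 ≤ ∑ z ∈ B, cost z := Finset.sum_nonneg fun z _ => hcost0 z
  have hnet : ∑ z ∈ D, (cost z - (adjMat G p z + adjMat G q z) * x z * μ) +
      ∑ z ∈ B, cost z ≤ 2 * μ * T := by
    rw [Finset.sum_sub_distrib]; linarith
  have hnet0 : ∀ z ∈ D, 0 ≤ cost z - (adjMat G p z + adjMat G q z) * x z * μ := fun z hz => by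
    have := hD z hz
    have : 0 ≤ x z * (T / ρ) := mul_nonneg (h.pos z).le (by positivity)
    linarith
  have hTμ : 2 * μ * T ≤ 2 / 238 := by nlinarith
  have hcz : ∀ z, 0 ≤ (adjMat G p z + adjMat G q z) * x z ∧
      (adjMat G p z + adjMat G q z) * x z ≤ 2 := fun z => by
    have := h.pos z
    have := h.le_one z
    have := adjMat_nonneg G p z
    have := adjMat_nonneg G q z
    have := adjMat_le_one G p z
    have := adjMat_le_one G q z
    constructor
    · positivity
    · nlinarith
  have hsmall : ∀ z ∈ rest G u, cost z ≤ 4 / 238 := by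
    intro z hz
    by_cases hzB : G.Adj p z ∧ G.Adj q z
    · have h1 := Finset.single_le_sum (f := cost) (fun z _ => hcost0 z)
        (Finset.mem_filter.2 ⟨hz, hzB⟩ : z ∈ B)
      have h2 := Finset.sum_nonneg hnet0
      linarith
    · have h1 := Finset.single_le_sum hnet0 (Finset.mem_filter.2 ⟨hz, hzB⟩ : z ∈ D)
      have h2 := mul_le_mul_of_nonneg_right (hcz z).2 hμ0.le
      nlinarith
  have hlarge : ∀ z ∈ rest G u, 49 / 50 ≤ x z := by
    intro z hz
    have h1 := h.one_le_degree hρ0 hE hz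
    have h2 := mul_le_mul_of_nonneg_right h1 (sub_nonneg.2 (h.le_one z))
    have h3 := hsmall z hz
    simp only [hcost] at h3
    linarith
  by_cases hDcard : 3 ≤ #D
  · have h1 : ∑ z ∈ D, (49 / 50 * (T / ρ)) <
        ∑ z ∈ D, (cost z - (adjMat G p z + adjMat G q z) * x z * μ) := by
      refine Finset.sum_lt_sum_of_nonempty (Finset.card_pos.1 (by omega)) fun z hz => ?_
      have h2 := hD z hz
      have h3 : 49 / 50 * (T / ρ) ≤ x z * (T / ρ) :=
        mul_le_mul_of_nonneg_right (hlarge z (Finset.mem_filter.1 hz).1) (by positivity)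
      linarith
    simp only [Finset.sum_const, nsmul_eq_mul] at h1
    have h2 : (3 : ℝ) ≤ #D := by exact_mod_cast hDcard
    have h3 : 3 * (49 / 50 * (T / ρ)) ≤ #D * (49 / 50 * (T / ρ)) :=
      mul_le_mul_of_nonneg_right h2 (by positivity)
    have h4 : 2 * μ * T ≤ 3 * (49 / 50 * (T / ρ)) := by
      have : μ * T ≤ 239 / 238 * (T / ρ) := by
        have := mul_le_mul_of_nonneg_right hμρ (by positivity : 0 ≤ T / ρ)
        calc μ * T = ρ * μ * (T / ρ) := by field_simp
          _ ≤ _ := this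
      have : 0 ≤ T / ρ := by positivity
      linarith
    linarith
  · have hWcard : (#(rest G u) : ℝ) ≤ r + 2 := by
      have h1 : #B + #D = #(rest G u) := Finset.card_filter_add_card_filter_not _
      have h2 : (#D : ℝ) ≤ 2 := by exact_mod_cast (by omega : #D ≤ 2)
      have h3 : (#B : ℝ) + #D = #(rest G u) := by exact_mod_cast h1
      linarith
    set w : ℝ := (#(rest G u) : ℝ) with hw
    have hup : ∀ a ∈ nbhd G u, ρ * x a ≤ w + 2 := by
      intro a ha
      have h1 : ∑ z ∈ rest G u, adjMat G a z * x z ≤ ∑ z ∈ rest G u, (1 : ℝ) :=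
        Finset.sum_le_sum fun z _ => by
          have := adjMat_le_one G a z
          have := adjMat_nonneg G a z
          have := h.le_one z
          have := h.pos z
          nlinarith
      simp only [Finset.sum_const, nsmul_eq_mul, mul_one] at h1
      have h2 : ∑ b ∈ nbhd G u, adjMat G a b * x b ≤ 1 := by
        by_cases hap : a = p
        · rw [hap, hE.sum_left]; exact h.le_one q
        by_cases haq : a = q
        · rw [haq, hE.symm.sum_left]; exact h.le_one p
        rw [Finset.sum_eq_zero fun b hb => ?_]
        · norm_num
        rw [adjMat_of_not_adj, zero_mul]
        intro hab
        rcases hE.unique a ha b hb hab with h3 | h3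
        · exact hap h3.1
        · exact haq h3.1
      rw [h.eigen_nbhd ha]
      linarith
    have hdeg' : ∀ z ∈ rest G u, 49 / 50 * ρ ^ 2 ≤ (w + 2) * ∑ a ∈ nbhd G u, adjMat G z a := by
      intro z hz
      have h1 : ρ * (ρ * x z) ≤ (w + 2) * ∑ a ∈ nbhd G u, adjMat G z a := by
        rw [h.eigen_rest_of_unique hE hz, Finset.mul_sum, Finset.mul_sum]
        refine Finset.sum_le_sum fun a ha => ?_
        have := mul_le_mul_of_nonneg_left (hup a ha) (adjMat_nonneg G z a)
        linarith
      have h2 := mul_le_mul_of_nonneg_right (hlarge z hz) (sq_nonneg ρ)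
      linarith
    set J := (rest G u).filter fun z => ¬ G.Adj v z with hJ
    have hzJ : z ∈ J := Finset.mem_filter.2 ⟨hz, hvz⟩
    have hj1 : (1 : ℝ) ≤ #J := by exact_mod_cast Finset.card_pos.2 ⟨z, hzJ⟩
    have hjw : (#J : ℝ) ≤ w := by
      rw [hw]; exact_mod_cast Finset.card_le_card (Finset.filter_subset _ _)
    have hlow : 1 + 49 / 50 * (w - #J) ≤ ρ * x v := by
      have h1 : #((rest G u).filter fun z => G.Adj v z) + #J = #(rest G u) :=
        Finset.card_filter_add_card_filter_not _
      have h2 : (#((rest G u).filter fun z => G.Adj v z) : ℝ) + #J = w := by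
        rw [hw]; exact_mod_cast h1
      have h3 : ∑ z ∈ (rest G u).filter (fun z => G.Adj v z), (49 / 50 : ℝ) ≤
          ∑ z ∈ rest G u, adjMat G v z * x z := by
        rw [Finset.sum_filter]
        refine Finset.sum_le_sum fun z hz => ?_
        by_cases hvz : G.Adj v z
        · simpa [hvz, adjMat_of_adj hvz] using hlarge z hz
        · simp [hvz, adjMat_of_not_adj hvz]
      simp only [Finset.sum_const, nsmul_eq_mul] at h3
      rw [h.eigen_nbhd hv]
      have h4 := h.sum_adjMat_mul_nonneg (nbhd G u) v
      have : w - #J = #((rest G u).filter fun z => G.Adj v z) := by linarith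
      rw [this]
      linarith
    have hJcost : ∀ z ∈ J, 49 / 50 * (1 + 49 / 50 * (w - #J)) ≤ (w + 2) * cost z := by
      intro z hz
      obtain ⟨hzW, hvz⟩ := Finset.mem_filter.1 hz
      have h1 := h.le_defect hE hzW hv hvz
      have h2 := mul_le_mul_of_nonneg_right (hdeg' z hzW) (sub_nonneg.2 (h.le_one z))
      have h3 := mul_le_mul_of_nonneg_left h1 hρ0.le
      simp only [hcost]
      linarith
    have hJsum : #J * (49 / 50 * (1 + 49 / 50 * (w - #J))) ≤
        (w + 2) * ∑ z ∈ rest G u, cost z := by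
      have h1 := Finset.sum_le_sum hJcost
      simp only [Finset.sum_const, nsmul_eq_mul, ← Finset.mul_sum] at h1
      have h2 : ∑ z ∈ J, cost z ≤ ∑ z ∈ rest G u, cost z :=
        Finset.sum_le_sum_of_subset_of_nonneg (Finset.filter_subset _ _) fun z _ _ => hcost0 z
      have h3 := mul_le_mul_of_nonneg_left h2 (by linarith : 0 ≤ w + 2)
      linarith
    have hQ : ∑ z ∈ rest G u, (adjMat G p z + adjMat G q z) * x z * μ ≤ w * (2 * μ) := by
      have := Finset.sum_le_sum fun z (_ : z ∈ rest G u) =>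
        mul_le_mul_of_nonneg_right (hcz z).2 hμ0.le
      simpa [Finset.sum_const] using this
    have h1 : 49 / 50 * (49 / 50 * w) ≤ #J * (49 / 50 * (1 + 49 / 50 * (w - #J))) := by
      nlinarith
    have h2 : (w + 2) * ∑ z ∈ rest G u, cost z ≤ (w + 2) * (w * (2 * μ)) :=
      mul_le_mul_of_nonneg_left (hC.trans hQ) (by linarith)
    have h3 : (w + 2) * μ ≤ 5 / 238 := by
      have : (w + 2) * μ ≤ (5 * r) * μ := mul_le_mul_of_nonneg_right (by linarith) hμ0.le
      linarith
    have h4 : w * ((w + 2) * μ) ≤ w * (5 / 238) := mul_le_mul_of_nonneg_left h3 (by linarith)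
    linarith

end IsScaledPerron

section SPlus

theorem sPlus_adj_inl_inl {s t : ℕ} (i j : Fin s) : ¬ (SPlus s t).Adj (.inl i) (.inl j) := by
  simp [SPlus]

theorem sPlus_adj_inl_inr {s t : ℕ} (i : Fin s) (j : Fin t) :
    (SPlus s t).Adj (.inl i) (.inr j) := by
  simp [SPlus]

theorem sPlus_adj_inr_inr {s t : ℕ} (i j : Fin t) :
    (SPlus s t).Adj (.inr i) (.inr j) ↔
      (i : ℕ) = 0 ∧ (j : ℕ) = 1 ∨ (i : ℕ) = 1 ∧ (j : ℕ) = 0 := by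
  simp only [SPlus, SimpleGraph.fromRel_adj]
  constructor
  · rintro ⟨-, h | h⟩ <;> simp at h <;> omega
  · intro h
    refine ⟨fun hij => ?_, h.imp (fun h => ?_) fun h => ?_⟩
    · rw [Sum.inr.inj hij] at h; omega
    · exact .inr ⟨i, j, rfl, rfl, h⟩
    · exact .inr ⟨j, i, rfl, rfl, h.2, h.1⟩

theorem exists_equiv_fin_of_ne {α : Type*} {t : ℕ} (e : α ≃ Fin t) {p q : α} (hpq : p ≠ q) :
    ∃ f : α ≃ Fin t, (f p : ℕ) = 0 ∧ (f q : ℕ) = 1 := by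
  have ht : 2 ≤ t := by
    by_contra! ht
    refine hpq (e.injective (Fin.ext ?_))
    have := (e p).2
    have := (e q).2
    omega
  let f := e.trans (Equiv.swap (e p) ⟨0, by omega⟩)
  have hfp : f p = ⟨0, by omega⟩ := by simp [f]
  refine ⟨f.trans (Equiv.swap (f q) ⟨1, by omega⟩), ?_, by simp⟩
  have h1 : f p ≠ f q := f.injective.ne hpq
  rw [Equiv.trans_apply, Equiv.swap_apply_of_ne_of_ne h1 (by rw [hfp]; simp), hfp]

theorem nonempty_iso_sPlus {V : Type*} (G : SimpleGraph V) (P : V → Prop) {s t : ℕ}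
    (hs : Nonempty ({v // P v} ≃ Fin s)) (ht : Nonempty ({v // ¬ P v} ≃ Fin t)) {p q : V}
    (hp : ¬ P p) (hq : ¬ P q) (hpq : p ≠ q) (hindep : ∀ v w, P v → P w → ¬ G.Adj v w)
    (hcross : ∀ v w, P v → ¬ P w → G.Adj v w)
    (hinner : ∀ v w, ¬ P v → ¬ P w → (G.Adj v w ↔ v = p ∧ w = q ∨ v = q ∧ w = p)) :
    Nonempty (G ≃g SPlus s t) := by
  classical
  obtain ⟨e⟩ := hs
  obtain ⟨e'⟩ := ht
  obtain ⟨f, hfp, hfq⟩ := exists_equiv_fin_of_ne e' (p := ⟨p, hp⟩) (q := ⟨q, hq⟩)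
    (by simpa using hpq)
  have h0 : ∀ v : {v // ¬ P v}, (f v : ℕ) = 0 ↔ (v : V) = p := fun v => by
    rw [← hfp, ← Fin.ext_iff, f.apply_eq_iff_eq, Subtype.ext_iff]
  have h1 : ∀ v : {v // ¬ P v}, (f v : ℕ) = 1 ↔ (v : V) = q := fun v => by
    rw [← hfq, ← Fin.ext_iff, f.apply_eq_iff_eq, Subtype.ext_iff]
  have key : ∀ a b : {v // P v} ⊕ {v // ¬ P v},
      (SPlus s t).Adj (Equiv.sumCongr e f a) (Equiv.sumCongr e f b) ↔
        G.Adj (Equiv.sumCompl P a) (Equiv.sumCompl P b) := by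
    rintro (a | a) (b | b)
    · simpa [sPlus_adj_inl_inl] using hindep a b a.2 b.2
    · simpa [sPlus_adj_inl_inr] using hcross a b a.2 b.2
    · simpa [sPlus_adj_inl_inr, (SPlus s t).adj_comm (.inr _)] using (hcross b a b.2 a.2).symm
    · simp [sPlus_adj_inr_inr, hinner a b a.2 b.2, h0, h1]
  exact ⟨⟨(Equiv.sumCompl P).symm.trans (Equiv.sumCongr e f), fun {a b} => by
    simpa using key ((Equiv.sumCompl P).symm a) ((Equiv.sumCompl P).symm b)⟩⟩

end SPlus

theorem colorable_two_of_inner_indep {G : SimpleGraph V} {u : V}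
    (h1 : ∀ v ∈ nbhd G u, ∀ w ∈ nbhd G u, ¬ G.Adj v w)
    (h2 : ∀ z ∈ rest G u, ∀ w ∈ rest G u, ¬ G.Adj z w) : G.Colorable 2 := by
  classical
  have hc : (G.Coloring Bool) := SimpleGraph.Coloring.mk (fun v => decide (G.Adj u v)) <| by
    intro v w hvw heq
    rw [decide_eq_decide] at heq
    by_cases hv : G.Adj u v
    · exact h1 v (mem_nbhd.2 hv) w (mem_nbhd.2 (heq.1 hv)) hvw
    · have hw : ¬ G.Adj u w := fun hw => hv (heq.2 hw)
      have hvu : v ≠ u := fun h => hw (h ▸ hvw)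
      have hwu : w ≠ u := fun h => hv (h ▸ hvw.symm)
      exact h2 v (mem_rest.2 ⟨hvu, hv⟩) w (mem_rest.2 ⟨hwu, hw⟩) hvw
  simpa using hc.colorable

theorem exists_hasUniqueInnerEdge {G : SimpleGraph V} {x : V → ℝ} {R : V → V → Prop} {u : V}
    (hnb : ¬ G.Colorable 2) (hR : IsOrientation x R)
    (hrest : ∑ z ∈ rest G u, ∑ w ∈ rest G u, adjMat G z w < 2)
    (hout : ∑ v ∈ nbhd G u, #(outNbrs G u R v) ≤ 1) : ∃ p q, HasUniqueInnerEdge G u p q := by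
  classical
  have h2 : ∀ z ∈ rest G u, ∀ w ∈ rest G u, ¬ G.Adj z w := fun z hz w hw hzw =>
    hrest.not_ge (two_le_sum_adjMat_of_adj hz hw hzw)
  obtain ⟨p, hp, q, hq, hpq, hRpq⟩ :
      ∃ p ∈ nbhd G u, ∃ q ∈ nbhd G u, G.Adj p q ∧ R p q := by
    by_contra! hno
    refine hnb (colorable_two_of_inner_indep (fun v hv w hw hvw => ?_) h2)
    exact hno v hv w hw hvw ((hR.iff_not _ _ hvw.ne).2 (hno w hw v hv hvw.symm))
  have key : ∀ v ∈ nbhd G u, ∀ w ∈ nbhd G u, G.Adj v w → R v w → v = p ∧ w = q := by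
    intro v hv w hw hvw hRvw
    have hwv : w ∈ outNbrs G u R v := mem_outNbrs.2 ⟨hw, hvw, hRvw⟩
    have hqp : q ∈ outNbrs G u R p := mem_outNbrs.2 ⟨hq, hpq, hRpq⟩
    obtain rfl : v = p := by
      by_contra hne
      have h3 := Finset.sum_le_sum_of_subset (f := fun v => #(outNbrs G u R v))
        (by simp [Finset.insert_subset_iff, hv, hp] : ({v, p} : Finset V) ⊆ nbhd G u)
      rw [Finset.sum_pair hne] at h3
      have := Finset.card_pos.2 ⟨w, hwv⟩
      have := Finset.card_pos.2 ⟨q, hqp⟩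
      omega
    have h3 := Finset.single_le_sum (f := fun v => #(outNbrs G u R v)) (fun _ _ => Nat.zero_le _) hv
    exact ⟨rfl, Finset.card_le_one.1 (h3.trans hout) w hwv q hqp⟩
  refine ⟨p, q, hp, hq, hpq, fun v hv w hw hvw => ?_, h2⟩
  by_cases hRvw : R v w
  · exact .inl (key v hv w hw hvw hRvw)
  · exact .inr (key w hw v hv hvw.symm ((hR.iff_not _ _ hvw.ne.symm).2 hRvw)).symm

namespace HasUniqueInnerEdge

variable {G : SimpleGraph V} {u p q : V}

theorem edge_count (hE : HasUniqueInnerEdge G u p q)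
    (hadj : ∀ v ∈ nbhd G u, ∀ z ∈ rest G u, G.Adj v z) :
    ∑ v, ∑ w, adjMat G v w = 2 * ((#(rest G u) + 1) * #(nbhd G u) + 1) := by
  classical
  have h1 := hE.sum_sum fun _ _ => 1
  have h2 : ∑ z ∈ rest G u, ∑ w ∈ rest G u, adjMat G z w = 0 :=
    Finset.sum_eq_zero fun z hz => by simpa using hE.rest_sum hz fun _ => 1
  have h3 : ∑ z ∈ rest G u, ∑ v ∈ nbhd G u, adjMat G z v = #(rest G u) * #(nbhd G u) := by
    rw [Finset.sum_congr rfl fun z hz => Finset.sum_congr rfl fun v hv =>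
      adjMat_of_adj (hadj v hv z hz).symm]
    simp
  simp only [mul_one] at h1
  rw [sum_adjMat_eq_split G u, h1, h2, h3]
  ring

theorem card_le (hE : HasUniqueInnerEdge G u p q)
    (hadj : ∀ v ∈ nbhd G u, ∀ z ∈ rest G u, G.Adj v z) {r : ℝ} (hB : BookBound G r) :
    (#(rest G u) + 1 : ℝ) ≤ r := by
  classical
  have h1 := hB p q hE.adj (insert u (rest G u)) fun z hz => by
    rcases Finset.mem_insert.1 hz with rfl | hz
    · exact ⟨(mem_nbhd.1 hE.left_mem).symm, (mem_nbhd.1 hE.right_mem).symm⟩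
    · exact ⟨hadj p hE.left_mem z hz, hadj q hE.right_mem z hz⟩
  rw [Finset.card_insert_of_notMem (by simp [mem_rest])] at h1
  exact_mod_cast h1

theorem nonempty_iso_sPlus (hE : HasUniqueInnerEdge G u p q)
    (hadj : ∀ v ∈ nbhd G u, ∀ z ∈ rest G u, G.Adj v z) :
    Nonempty (G ≃g SPlus (#(rest G u) + 1) #(nbhd G u)) := by
  classical
  have hP : ∀ {v}, v ∈ insert u (rest G u) ↔ ¬ G.Adj u v := fun {v} => by
    by_cases hv : v = u <;> simp [hv, mem_rest]
  have hP2 : ∀ {v}, v ∉ insert u (rest G u) ↔ v ∈ nbhd G u := fun {v} => by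
    rw [hP, not_not, mem_nbhd]
  refine _root_.nonempty_iso_sPlus G (· ∈ insert u (rest G u)) ⟨Fintype.equivFinOfCardEq ?_⟩
    ⟨Fintype.equivFinOfCardEq ?_⟩ (hP2.2 hE.left_mem) (hP2.2 hE.right_mem) hE.adj.ne ?_ ?_ ?_
  · rw [Fintype.card_coe, Finset.card_insert_of_notMem (by simp [mem_rest])]
  · rw [Fintype.card_subtype]
    congr 1
    ext v
    rw [Finset.mem_filter, hP2]
    simp
  · intro v w hv hw
    rcases Finset.mem_insert.1 hv with rfl | hv
    · exact hP.1 hw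
    · rcases Finset.mem_insert.1 hw with rfl | hw
      · exact fun h => (mem_rest.1 hv).2 h.symm
      · exact hE.rest_not_adj v hv w hw
  · intro v w hv hw
    rw [hP2] at hw
    rcases Finset.mem_insert.1 hv with rfl | hv
    · exact mem_nbhd.1 hw
    · exact (hadj w hw v hv).symm
  · intro v w hv hw
    rw [hP2] at hv hw
    refine ⟨hE.unique v hv w hw, ?_⟩
    rintro (⟨rfl, rfl⟩ | ⟨rfl, rfl⟩)
    · exact hE.adj
    · exact hE.adj.symm

end HasUniqueInnerEdge

end Core

/-- Let `G` be a connected non-bipartite `B_{r+1}`-free graph with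
`m ≥ (240r)²` edges and spectral radius `ρ`.  Then `ρ² < m - 1 + 2/(ρ - 1)`, unless
`G ≅ S⁺_{m,s}` for some `s ∈ {1, …, r}` with `s ∣ m - 1`. -/
theorem nonbipartite_spectral_bound {V : Type*} [Fintype V] [DecidableEq V]
    (G : SimpleGraph V) (hconn : G.Connected) (hnb : ¬ G.Colorable 2)
    (r m : ℕ) (hr : 1 ≤ r)
    (hm : G.edgeSet.ncard = m) (hm' : (240 * r) ^ 2 ≤ m)
    (hfree : ∀ u v, G.Adj u v → (G.neighborSet u ∩ G.neighborSet v).ncard ≤ r) :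
    specRad G ^ 2 < (m : ℝ) - 1 + 2 / (specRad G - 1) ∨
      ∃ s : ℕ, 1 ≤ s ∧ s ≤ r ∧ s ∣ (m - 1) ∧
        Nonempty (G ≃g SPlus s ((m - 1) / s)) := by
  by_contra! hcon
  obtain ⟨hgap, hno⟩ := hcon
  obtain ⟨x, u, h⟩ := exists_isScaledPerron G hconn
  obtain ⟨R, hR⟩ := exists_isOrientation x
  have hrR : (1 : ℝ) ≤ r := by exact_mod_cast hr
  have hmR : (240 * r : ℝ) ^ 2 ≤ m := by exact_mod_cast hm'
  have hρ1 : 1 < specRad G := one_lt_specRad G hconn (by nlinarith)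
  have hμ : 0 < 2 / (specRad G - 1) := div_pos two_pos (by linarith)
  have hρ : 239 * r ≤ specRad G := by
    refine le_of_sq_le_sq ?_ (by linarith)
    nlinarith
  have hB : BookBound G r := fun v w hvw s hs => by
    have h1 : (s : Set V) ⊆ G.neighborSet v ∩ G.neighborSet w := fun q hq => hs q hq
    have h2 := (Set.ncard_le_ncard h1 (Set.toFinite _)).trans (hfree v w hvw)
    rw [Set.ncard_coe_finset] at h2
    exact_mod_cast h2
  have hsum := sum_adjMat G
  rw [hm] at hsum
  obtain ⟨hrest, hout⟩ := h.structure_of_gap hrR hB hρ hR (by rw [hsum]; linarith)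
  obtain ⟨p, q, hE⟩ := exists_hasUniqueInnerEdge hnb hR hrest hout
  have hadj : ∀ v ∈ nbhd G u, ∀ z ∈ rest G u, G.Adj v z := fun v hv z hz =>
    h.adj_of_gap hrR hB hρ hE (by rw [hsum]; linarith) hv hz
  have hcount : m = (Finset.card (rest G u) + 1) * Finset.card (nbhd G u) + 1 := by
    have h1 := hE.edge_count hadj
    rw [hsum] at h1
    exact_mod_cast mul_left_cancel₀ two_ne_zero h1
  have hm1 : m - 1 = (Finset.card (rest G u) + 1) * Finset.card (nbhd G u) := by omega
  refine (hno _ (Nat.succ_pos _) (by exact_mod_cast hE.card_le hadj hB)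
    (Dvd.intro _ hm1.symm)).false ?_
  rw [hm1, Nat.mul_div_cancel_left _ (Nat.succ_pos _)]
  exact (hE.nonempty_iso_sPlus hadj).some
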